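/- Let (X,r) be a finite primitive involutive non-degenerate set-theoretic solution of the Yang–Baxter equation of cardinality p^m, for some prime p and some integer m > 1. Then (X,r) is irretractable, i.e. σ_x ≠ σ_y for all distinct x, y ∈ X. -/

import Mathlib

/-- The map `σ_x : y ↦` first component of `r(x,y)`. -/
def sigmaMap {X : Type*} (r : X × X → X × X) (x : X) : X → X := fun y => (r (x, y)).1

/-- The map `γ_y : x ↦` second component of `r(x,y)`. -/
def gammaMap {X : Type*} (r : X × X → X × X) (y : X) : X → X := fun x => (r (x, y)).2

/-- `r₁₂ = r × id` on `X³`. -/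
def rMap12 {X : Type*} (r : X × X → X × X) : X × X × X → X × X × X :=
  fun p => ((r (p.1, p.2.1)).1, (r (p.1, p.2.1)).2, p.2.2)

/-- `r₂₃ = id × r` on `X³`. -/
def rMap23 {X : Type*} (r : X × X → X × X) : X × X × X → X × X × X :=
  fun p => (p.1, r p.2)

/-- `(X, r)` is an involutive non-degenerate set-theoretic solution of the
Yang–Baxter equation: `r² = id`, all `σ_x` and `γ_y` are bijective, and
`r₁₂ r₂₃ r₁₂ = r₂₃ r₁₂ r₂₃`. -/
def IsYBSolution {X : Type*} (r : X × X → X × X) : Prop :=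
  (∀ p, r (r p) = p) ∧
  (∀ x, Function.Bijective (sigmaMap r x)) ∧
  (∀ y, Function.Bijective (gammaMap r y)) ∧
  rMap12 r ∘ rMap23 r ∘ rMap12 r = rMap23 r ∘ rMap12 r ∘ rMap23 r

/-- The permutation `σ_x` of `X`, for a solution `(X,r)`. -/
noncomputable def sigmaPerm {X : Type*} (r : X × X → X × X) (h : IsYBSolution r) (x : X) :
    Equiv.Perm X := Equiv.ofBijective (sigmaMap r x) (h.2.1 x)

/-- The permutation group `𝒢(X,r) = ⟨σ_x ∣ x ∈ X⟩ ≤ Sym_X` of a solution `(X,r)`. -/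
noncomputable def permGroup {X : Type*} (r : X × X → X × X) (h : IsYBSolution r) :
    Subgroup (Equiv.Perm X) := Subgroup.closure (Set.range (sigmaPerm r h))

/-- A group `G` acts primitively on `X` if the action is transitive and every
block of the action is trivial (a subsingleton or all of `X`). -/
def IsPrimitiveAction (G : Type*) (X : Type*) [Group G] [MulAction G X] : Prop :=
  MulAction.IsPretransitive G X ∧ ∀ B : Set X, MulAction.IsBlock G B → MulAction.IsTrivialBlock B

/-- A finite solution `(X,r)` is primitive if `𝒢(X,r)` acts primitively on `X`. -/
noncomputable def IsPrimitiveSolution {X : Type*} (r : X × X → X × X) (h : IsYBSolution r) : Prop :=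
  IsPrimitiveAction ↥(permGroup r h) X

section

variable {X : Type*} {r : X × X → X × X}

/-- The first component of the braid relation, `σ_x σ_y = σ_{σ_x(y)} σ_{γ_y(x)}`. -/
theorem sigmaPerm_mul_sigmaPerm (h : IsYBSolution r) (x y : X) :
    sigmaPerm r h x * sigmaPerm r h y =
      sigmaPerm r h (r (x, y)).1 * sigmaPerm r h (r (x, y)).2 := by
  ext z
  exact (congrArg Prod.fst (congrFun h.2.2.2 (x, y, z))).symm

theorem sigmaPerm_fst_snd (h : IsYBSolution r) (x y : X) :
    sigmaPerm r h (r (x, y)).1 (r (x, y)).2 = x :=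
  congrArg Prod.fst (h.1 (x, y))

theorem sigmaPerm_mul_sigmaPerm_inv_apply (h : IsYBSolution r) (x y : X) :
    sigmaPerm r h x * sigmaPerm r h ((sigmaPerm r h x)⁻¹ y) =
      sigmaPerm r h y * sigmaPerm r h ((sigmaPerm r h y)⁻¹ x) := by
  have hy : (r (x, (sigmaPerm r h x)⁻¹ y)).1 = y := Equiv.apply_symm_apply (sigmaPerm r h x) y
  have hx := sigmaPerm_fst_snd h x ((sigmaPerm r h x)⁻¹ y)
  rw [sigmaPerm_mul_sigmaPerm, hy]
  rw [hy] at hx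
  rw [← Equiv.Perm.eq_inv_iff_eq.mpr hx]

/-- The equivalence relation `σ_y = σ_z` is invariant under `𝒢(X,r)`. -/
theorem sigmaPerm_apply_eq_of_mem_permGroup [Finite X] (h : IsYBSolution r)
    {g : Equiv.Perm X} (hg : g ∈ permGroup r h) :
    ∀ y z, sigmaPerm r h y = sigmaPerm r h z → sigmaPerm r h (g y) = sigmaPerm r h (g z) := by
  let S : Submonoid (Equiv.Perm X) :=
    { carrier := {g | ∀ y z, sigmaPerm r h y = sigmaPerm r h z →
        sigmaPerm r h (g y) = sigmaPerm r h (g z)}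
      one_mem' := fun _ _ hyz => hyz
      mul_mem' := fun ha hb y z hyz => ha _ _ (hb y z hyz) }
  have inv_mem : ∀ a ∈ S, a⁻¹ ∈ S := fun a ha =>
    Submonoid.powers_le.mpr ha
      (mem_powers_iff_mem_zpowers.mpr (inv_mem (Subgroup.mem_zpowers a)))
  change g ∈ S
  induction hg using Subgroup.closure_induction with
  | mem g hg =>
    obtain ⟨x, rfl⟩ := hg
    rw [← inv_inv (sigmaPerm r h x)]
    refine inv_mem _ fun y z hyz => ?_
    have hy := sigmaPerm_mul_sigmaPerm_inv_apply h x y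
    rw [hyz, ← sigmaPerm_mul_sigmaPerm_inv_apply h x z] at hy
    exact mul_left_cancel hy
  | one => exact S.one_mem
  | mul _ _ _ _ ha hb => exact S.mul_mem ha hb
  | inv a _ ha => exact inv_mem a ha

theorem isBlock_sigmaPerm_eq [Finite X] (h : IsYBSolution r) (x : X) :
    MulAction.IsBlock (permGroup r h) {y | sigmaPerm r h y = sigmaPerm r h x} := by
  have smul_mem (g : permGroup r h) (y : X) (hy : sigmaPerm r h y = sigmaPerm r h x)
      (hgx : sigmaPerm r h (g • x) = sigmaPerm r h x) :
      sigmaPerm r h (g • y) = sigmaPerm r h x :=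
    (sigmaPerm_apply_eq_of_mem_permGroup h g.2 y x hy).trans hgx
  refine MulAction.isBlock_iff_smul_eq_of_mem.mpr fun g a ha hga => ?_
  have hgx : sigmaPerm r h (g • x) = sigmaPerm r h x :=
    (sigmaPerm_apply_eq_of_mem_permGroup h g.2 a x ha).symm.trans hga
  have hgx' : sigmaPerm r h (g⁻¹ • x) = sigmaPerm r h x := by
    have := sigmaPerm_apply_eq_of_mem_permGroup h g⁻¹.2 (g • x) x hgx
    exact this.symm.trans (congrArg (sigmaPerm r h) (inv_smul_smul g x))
  ext y
  rw [Set.mem_smul_set_iff_inv_smul_mem]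
  refine ⟨fun hy => ?_, fun hy => smul_mem g⁻¹ y hy hgx'⟩
  rw [Set.mem_ofPred_eq, ← smul_inv_smul g y]
  exact smul_mem g _ hy hgx

/-- A set on which a cyclic group acts primitively does not have cardinality `p ^ m` with
`m > 1`. -/
theorem IsPrimitiveAction.card_ne_prime_pow {G : Type*} [Group G] [MulAction G X] [Fintype X]
    (hG : IsPrimitiveAction G X) {g : G} (hg : ∀ a, a ∈ Subgroup.zpowers g)
    {p m : ℕ} (hp : p.Prime) (hm : 1 < m) : Fintype.card X ≠ p ^ m := by
  intro hcard
  have := hG.1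
  have : Nonempty X := Fintype.card_pos_iff.mp (hcard ▸ pow_pos hp.pos m)
  obtain ⟨x⟩ := this
  have hperiod (a : G) : Function.minimalPeriod (a • ·) x =
      (MulAction.orbit (Subgroup.zpowers a) x).ncard := by
    have := Fintype.ofFinite (MulAction.orbit (Subgroup.zpowers a) x)
    rw [MulAction.minimalPeriod_eq_card, ← Nat.card_eq_fintype_card, Nat.card_coe_set_eq]
  have horbit : MulAction.orbit (Subgroup.zpowers g) x = Set.univ := by
    refine Set.eq_univ_of_forall fun y => ?_
    obtain ⟨a, rfl⟩ := MulAction.exists_smul_eq G x y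
    exact ⟨⟨a, hg a⟩, rfl⟩
  have hg_period : Function.minimalPeriod (g • ·) x = p ^ m := by
    rw [hperiod, horbit, Set.ncard_univ, Nat.card_eq_fintype_card, hcard]
  have hB : (MulAction.orbit (Subgroup.zpowers (g ^ p)) x).ncard = p ^ (m - 1) := by
    rw [← hperiod, ← smul_iterate, Function.minimalPeriod_iterate_eq_div_gcd hp.ne_zero,
      hg_period, Nat.gcd_eq_right (dvd_pow_self p (by lia)), Nat.pow_div (by lia) hp.pos |>.symm]
    simp
  have : (Subgroup.zpowers (g ^ p)).Normal := by
    refine ⟨fun a ha b => ?_⟩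
    obtain ⟨i, rfl⟩ := hg a
    obtain ⟨j, rfl⟩ := hg b
    rwa [(Commute.zpow_zpow_self g j i).eq, mul_inv_cancel_right]
  rcases hG.2 _ (MulAction.IsBlock.orbit_of_normal (N := Subgroup.zpowers (g ^ p)) x) with hs | hu
  · have := Set.ncard_le_one_iff_subsingleton.mpr hs
    have := Nat.one_lt_pow (show m - 1 ≠ 0 by lia) hp.one_lt
    lia
  · rw [hu, Set.ncard_univ, Nat.card_eq_fintype_card, hcard] at hB
    have := Nat.pow_right_injective hp.two_le hB
    lia

end

/-- Ballester-Bolinches: a finite primitive solution `(X,r)` of the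
YBE of cardinality `p^m`, `p` prime, `m > 1`, is irretractable: `σ_x ≠ σ_y`
for all distinct `x, y ∈ X`. -/
theorem primitive_prime_power_irretractable {X : Type*} [Fintype X]
    (r : X × X → X × X) (h : IsYBSolution r)
    (p m : ℕ) (hp : p.Prime) (hm : 1 < m) (hcard : Fintype.card X = p ^ m)
    (hprim : IsPrimitiveSolution r h) :
    ∀ x y : X, x ≠ y → sigmaMap r x ≠ sigmaMap r y := by
  intro x y hxy hσ
  have hσ' : sigmaPerm r h x = sigmaPerm r h y := Equiv.ext (congrFun hσ)
  have hall : ∀ z, sigmaPerm r h z = sigmaPerm r h y := by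
    rcases hprim.2 _ (isBlock_sigmaPerm_eq h y) with hs | hu
    · exact absurd (hs hσ' rfl) hxy
    · exact Set.eq_univ_iff_forall.mp hu
  have hrange : Set.range (sigmaPerm r h) = {sigmaPerm r h y} :=
    Set.eq_singleton_iff_unique_mem.mpr ⟨⟨y, rfl⟩, Set.forall_mem_range.mpr hall⟩
  have hgroup : permGroup r h = Subgroup.zpowers (sigmaPerm r h y) := by
    rw [permGroup, hrange, Subgroup.zpowers_eq_closure]
  refine IsPrimitiveAction.card_ne_prime_pow hprim
    (g := ⟨sigmaPerm r h y, Subgroup.subset_closure ⟨y, rfl⟩⟩) (fun ⟨a, ha⟩ => ?_) hp hm hcard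
  rw [hgroup] at ha
  obtain ⟨i, rfl⟩ := ha
  exact ⟨i, rfl⟩
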